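/- Let S be a complete separable metric space, let f ∈ F₁(a,b) be admissible and strictly admissible, and let Γ ⊂ C_b(S) be admissible and strictly admissible. Let Γ ⊂ Γ̃ ⊂ M(S) (the measurable real-valued functions on S) and let V : Γ̃ × P(S) × P(S) → [0,∞] satisfy V[g;Q,P] = 0 for all g ∈ Γ and all Borel probability measures Q, P. Define D_f^V(Q‖P) = sup over g ∈ Γ̃ of {(E_Q[g] − Λ_f^P[g]) − V[g;Q,P]}, with the conventions ∞ − ∞ = −∞ and −∞ + ∞ = −∞. Then D_f^V has the divergence property, and D_f^Γ(Q‖P) ≤ D_f^V(Q‖P) ≤ D_f(Q‖P) for all Borel probability measures Q, P. -/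

import Mathlib

open MeasureTheory Filter Set Topology ENNReal
open scoped Classical

noncomputable section

/-- The set of bounded measurable real-valued functions on `Ω`. -/
def Mb (Ω : Type*) [MeasurableSpace Ω] : Set (Ω → ℝ) :=
  {g | Measurable g ∧ ∃ C : ℝ, ∀ x, |g x| ≤ C}

/-- The set of bounded continuous real-valued functions on `S`. -/
def Cb (S : Type*) [TopologicalSpace S] : Set (S → ℝ) :=
  {g | Continuous g ∧ ∃ C : ℝ, ∀ x, |g x| ≤ C}

/-- The positive part of an extended real number, as an element of `ℝ≥0∞`. -/
def posE (x : EReal) : ℝ≥0∞ := if x = ⊤ then ⊤ else ENNReal.ofReal x.toReal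

/-- The extended-real-valued integral of an `EReal`-valued function, defined as the
difference of the lower integrals of the positive and negative parts, with the
convention `∞ - ∞ = -∞`. -/
def eIntegral {Ω : Type*} [MeasurableSpace Ω] (P : Measure Ω) (h : Ω → EReal) : EReal :=
  ((∫⁻ x, posE (h x) ∂P : ℝ≥0∞) : EReal) - ((∫⁻ x, posE (-(h x)) ∂P : ℝ≥0∞) : EReal)

/-- The Legendre transform `f*(y) = sup_x {x*y - f(x)}` of `f : ℝ → (-∞,∞]`. -/
def fstar (f : ℝ → EReal) (y : ℝ) : EReal := ⨆ x : ℝ, (((x * y : ℝ) : EReal) - f x)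

/-- `f : ℝ → (-∞,∞]` is (the convex LSC extension of) an element of `F₁(a,b)`:
convex, lower semicontinuous, never `-∞`, finite exactly on the interval `(a,b)`
(with `+∞` strictly outside `[a,b]`), and `f(1) = 0` with `a < 1 < b`. -/
structure IsF1 (a b : EReal) (f : ℝ → EReal) : Prop where
  a_lt_one : a < ((1 : ℝ) : EReal)
  one_lt_b : ((1 : ℝ) : EReal) < b
  convex : ∀ x y t : ℝ, 0 < t → t < 1 →
    f (t * x + (1 - t) * y) ≤ ((t : ℝ) : EReal) * f x + (((1 - t : ℝ)) : EReal) * f y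
  lsc : LowerSemicontinuous f
  ne_bot : ∀ x, f x ≠ ⊥
  finite_on : ∀ x : ℝ, a < (x : EReal) → (x : EReal) < b → f x ≠ ⊤
  top_outside : ∀ x : ℝ, ((x : EReal) < a ∨ b < (x : EReal)) → f x = ⊤
  at_one : f 1 = 0

/-- `Λ_f^P[g] = inf_{ν ∈ ℝ} {ν + E_P[f*(g - ν)]}`. -/
def LambdaF {Ω : Type*} [MeasurableSpace Ω] (f : ℝ → EReal) (P : Measure Ω) (g : Ω → ℝ) :
    EReal :=
  ⨅ ν : ℝ, ((ν : EReal) + eIntegral P (fun x => fstar f (g x - ν)))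

/-- The classical `f`-divergence `D_f(Q‖P) = E_P[f(dQ/dP)]` if `Q ≪ P`, else `∞`. -/
def fDivE {Ω : Type*} [MeasurableSpace Ω] (f : ℝ → EReal) (Q P : Measure Ω) : EReal :=
  if Q ≪ P then eIntegral P (fun x => f ((Q.rnDeriv P x).toReal)) else ⊤

/-- The `(f,Γ)`-divergence `D_f^Γ(Q‖P) = sup_{g ∈ Γ} {E_Q[g] - Λ_f^P[g]}`. -/
def fGammaDiv {Ω : Type*} [MeasurableSpace Ω] (f : ℝ → EReal) (Γ : Set (Ω → ℝ))
    (Q P : Measure Ω) : EReal :=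
  ⨆ g ∈ Γ, (((∫ x, g x ∂Q : ℝ) : EReal) - LambdaF f P g)

/-- The `Γ`-IPM `W^Γ(Q,P) = sup_{g ∈ Γ} {E_Q[g] - E_P[g]}`. -/
def ipmW {Ω : Type*} [MeasurableSpace Ω] (Γ : Set (Ω → ℝ)) (Q P : Measure Ω) : EReal :=
  ⨆ g ∈ Γ, (((∫ x, g x ∂Q : ℝ) : EReal) - ((∫ x, g x ∂P : ℝ) : EReal))


/-- Integration of a function against a finite signed measure, via the Jordan
decomposition. -/
def signedIntegral {S : Type*} [MeasurableSpace S] (μ : MeasureTheory.SignedMeasure S)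
    (g : S → ℝ) : ℝ :=
  (∫ x, g x ∂μ.toJordanDecomposition.posPart) - ∫ x, g x ∂μ.toJordanDecomposition.negPart

/-- The weak topology on real-valued functions on `S` generated by the maps
`g ↦ ∫ g dμ` for all finite signed (Borel) measures `μ` on `S`. -/
def weakTop (S : Type*) [MeasurableSpace S] : TopologicalSpace (S → ℝ) :=
  ⨅ μ : MeasureTheory.SignedMeasure S,
    TopologicalSpace.induced (fun g => signedIntegral μ g) inferInstance

/-- A set `Ψ` of functions is `P(S)`-determining: if two probability measures give the
same integral to every `ψ ∈ Ψ`, then they are equal. -/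
def Determining {S : Type*} [MeasurableSpace S] (Ψ : Set (S → ℝ)) : Prop :=
  ∀ Q P : Measure S, IsProbabilityMeasure Q → IsProbabilityMeasure P →
    (∀ ψ ∈ Ψ, (∫ x, ψ x ∂Q) = ∫ x, ψ x ∂P) → Q = P

/-- `Γ ⊆ C_b(S)` is admissible: it contains `0`, is convex, and is closed in `C_b(S)` for
the weak topology generated by the finite signed measures. -/
def AdmissibleGamma {S : Type*} [TopologicalSpace S] [MeasurableSpace S]
    (Γ : Set (S → ℝ)) : Prop :=
  (fun _ => (0 : ℝ)) ∈ Γ ∧ Convex ℝ Γ ∧ Γ ⊆ Cb S ∧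
    ∀ g ∈ Cb S, g ∈ @closure _ (weakTop S) Γ → g ∈ Γ

/-- `Γ` is strictly admissible: there is a `P(S)`-determining set `Ψ ⊆ C_b(S)` such that
for all `ψ ∈ Ψ` there are `c ∈ ℝ` and `ε > 0` with `c ± εψ ∈ Γ`. -/
def StrictlyAdmissibleGamma {S : Type*} [TopologicalSpace S] [MeasurableSpace S]
    (Γ : Set (S → ℝ)) : Prop :=
  ∃ Ψ : Set (S → ℝ), Ψ ⊆ Cb S ∧ Determining Ψ ∧
    ∀ ψ ∈ Ψ, ∃ c ε : ℝ, 0 < ε ∧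
      (fun x => c + ε * ψ x) ∈ Γ ∧ (fun x => c - ε * ψ x) ∈ Γ

/-- `f` is admissible: `f*` is finite everywhere and `lim_{y → -∞} f*(y) < ∞`. -/
def AdmissibleF (f : ℝ → EReal) : Prop :=
  (∀ y : ℝ, fstar f y ≠ ⊤) ∧ ∃ M : ℝ, ∀ᶠ y in Filter.atBot, fstar f y ≤ (M : EReal)

/-- `f` is strictly convex at `1`: `f` is not affine on any neighborhood of `1`. -/
def StrictlyConvexAtOne (f : ℝ → EReal) : Prop :=
  ∀ ε : ℝ, 0 < ε → ¬ ∃ m q : ℝ, ∀ x : ℝ, |x - 1| < ε → f x = ((m * x + q : ℝ) : EReal)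

/-- `f` is strictly convex on the interval `(a,b)` (with `a, b ∈ [-∞,∞]`). -/
def StrictConvexOnAB (a b : EReal) (f : ℝ → EReal) : Prop :=
  ∀ x y t : ℝ, a < (x : EReal) → (x : EReal) < b → a < (y : EReal) → (y : EReal) < b →
    x ≠ y → 0 < t → t < 1 →
    f (t * x + (1 - t) * y) < ((t : ℝ) : EReal) * f x + (((1 - t : ℝ)) : EReal) * f y


/-- The soft-constraint divergence
`D_f^V(Q‖P) = sup_{g ∈ Γ̃} {(E_Q[g] - Λ_f^P[g]) - V[g;Q,P]}`, with the conventions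
`∞ - ∞ = -∞` and `-∞ + ∞ = -∞` built into the `EReal` arithmetic and `eIntegral`. -/
def DfV {S : Type*} [MeasurableSpace S] (f : ℝ → EReal) (Γt : Set (S → ℝ))
    (V : (S → ℝ) → Measure S → Measure S → ℝ≥0∞) (Q P : Measure S) : EReal :=
  ⨆ g ∈ Γt, ((eIntegral Q (fun x => ((g x : ℝ) : EReal)) - LambdaF f P g)
    - ((V g Q P : ℝ≥0∞) : EReal))

end


theorem posE_coe (r : ℝ) : posE (r : EReal) = ENNReal.ofReal r := by
  simp [posE]

theorem posE_mono {x y : EReal} (h : x ≤ y) : posE x ≤ posE y := by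
  induction y with
  | top => simp [posE]
  | bot => simp [le_bot_iff.1 h]
  | coe y =>
    induction x with
    | top => simp at h
    | bot => simp [posE]
    | coe x => rw [posE_coe, posE_coe]; exact ENNReal.ofReal_le_ofReal (by exact_mod_cast h)

theorem eInt_mono {Ω : Type*} [MeasurableSpace Ω] (P : Measure Ω) {h k : Ω → EReal}
    (hk : ∀ x, h x ≤ k x) : eIntegral P h ≤ eIntegral P k := by
  unfold eIntegral
  apply EReal.sub_le_sub
  · exact_mod_cast lintegral_mono fun x => posE_mono (hk x)
  · exact_mod_cast lintegral_mono fun x => posE_mono (EReal.neg_le_neg_iff.2 (hk x))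

theorem eInt_congr {Ω : Type*} [MeasurableSpace Ω] (P : Measure Ω) {h k : Ω → EReal}
    (hk : ∀ᵐ x ∂P, h x = k x) : eIntegral P h = eIntegral P k := by
  unfold eIntegral
  congr 2
  · exact lintegral_congr_ae (by filter_upwards [hk] with x hx; simp [hx])
  · exact lintegral_congr_ae (by filter_upwards [hk] with x hx; simp [hx])

theorem eInt_coe_def {Ω : Type*} [MeasurableSpace Ω] (P : Measure Ω) (u : Ω → ℝ) :
    eIntegral P (fun x => (u x : EReal)) =
      ((∫⁻ x, ENNReal.ofReal (u x) ∂P : ℝ≥0∞) : EReal)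
        - ((∫⁻ x, ENNReal.ofReal (-(u x)) ∂P : ℝ≥0∞) : EReal) := by
  unfold eIntegral
  simp only [← EReal.coe_neg, posE_coe]

theorem lint_ne_top {Ω : Type*} [MeasurableSpace Ω] {P : Measure Ω} {u : Ω → ℝ}
    (hu : Integrable u P) : ∫⁻ x, ENNReal.ofReal (u x) ∂P ≠ ⊤ :=
  (hu.lintegral_lt_top).ne

theorem ereal_coe_ennreal {x : ℝ≥0∞} (h : x ≠ ⊤) : (x : EReal) = ((x.toReal : ℝ) : EReal) :=
  (EReal.coe_toReal (by simpa using h) (by simp)).symm.trans (by simp)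

theorem eInt_coe {Ω : Type*} [MeasurableSpace Ω] {P : Measure Ω} {u : Ω → ℝ}
    (hu : Integrable u P) :
    eIntegral P (fun x => (u x : EReal)) = ((∫ x, u x ∂P : ℝ) : EReal) := by
  rw [eInt_coe_def, integral_eq_lintegral_pos_part_sub_lintegral_neg_part hu,
    ereal_coe_ennreal (lint_ne_top hu),
    ereal_coe_ennreal (x := ∫⁻ x, ENNReal.ofReal (-(u x)) ∂P) (lint_ne_top hu.neg)]
  simp

theorem int_of {Ω : Type*} [MeasurableSpace Ω] {P : Measure Ω} {u : Ω → ℝ}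
    (hm : AEStronglyMeasurable u P) (h1 : ∫⁻ x, ENNReal.ofReal (u x) ∂P ≠ ⊤)
    (h2 : ∫⁻ x, ENNReal.ofReal (-(u x)) ∂P ≠ ⊤) : Integrable u P := by
  refine ⟨hm, ?_⟩
  have hm' : AEMeasurable u P := hm.aemeasurable
  have : ∫⁻ x, ‖u x‖ₑ ∂P ≤ ∫⁻ x, ENNReal.ofReal (u x) ∂P + ∫⁻ x, ENNReal.ofReal (-(u x)) ∂P := by
    rw [← lintegral_add_left' hm'.ennreal_ofReal]
    apply lintegral_mono
    intro x
    simp only [Real.enorm_eq_ofReal_abs]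
    rcases abs_cases (u x) with ⟨h, _⟩ | ⟨h, _⟩ <;> rw [h] <;> simp
  exact lt_of_le_of_lt this (ENNReal.add_lt_top.2 ⟨h1.lt_top, h2.lt_top⟩)

theorem convR {a b : EReal} {f : ℝ → EReal} (hf : IsF1 a b f) {x y u v t : ℝ}
    (h0 : 0 < t) (h1 : t < 1) (hx : f x = (u : EReal)) (hy : f y = (v : EReal)) :
    f (t * x + (1 - t) * y) ≤ ((t * u + (1 - t) * v : ℝ) : EReal) := by
  have := hf.convex x y t h0 h1
  rw [hx, hy] at this
  exact_mod_cast this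

theorem finR {a b : EReal} {f : ℝ → EReal} (hf : IsF1 a b f) {x : ℝ} (h : f x ≠ ⊤) :
    ∃ v : ℝ, f x = (v : EReal) :=
  ⟨(f x).toReal, (EReal.coe_toReal h (hf.ne_bot x)).symm⟩

theorem slope_le {a b : EReal} {f : ℝ → EReal} (hf : IsF1 a b f) {x z u v : ℝ}
    (hx : x < 1) (hz : 1 < z) (hu : f x = (u : EReal)) (hv : f z = (v : EReal)) :
    u / (x - 1) ≤ v / (z - 1) := by
  have hxz : 0 < z - x := by linarith
  have h := convR hf (t := (z - 1) / (z - x)) (by apply div_pos <;> linarith)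
    (by rw [div_lt_one hxz]; linarith) hu hv
  have e : (z - 1) / (z - x) * x + (1 - (z - 1) / (z - x)) * z = 1 := by
    field_simp; ring
  rw [e, hf.at_one] at h
  have h' : 0 ≤ (z - 1) / (z - x) * u + (1 - (z - 1) / (z - x)) * v := by exact_mod_cast h
  have e2 : (z - 1) / (z - x) * u + (1 - (z - 1) / (z - x)) * v
      = ((z - 1) * u + (1 - x) * v) / (z - x) := by field_simp; ring
  rw [e2, le_div_iff₀ hxz] at h'
  have e3 : u / (x - 1) = (-u) / (1 - x) := by rw [← neg_div_neg_eq]; ring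
  rw [e3, div_le_div_iff₀ (by linarith) (by linarith)]
  nlinarith

theorem exists_subgrad {a b : EReal} {f : ℝ → EReal} (hf : IsF1 a b f) :
    ∃ y0 : ℝ, ∀ x : ℝ, ((y0 * (x - 1) : ℝ) : EReal) ≤ f x := by
  obtain ⟨x1, hax, hx1⟩ := EReal.lt_iff_exists_real_btwn.1 hf.a_lt_one
  obtain ⟨z1, hz1, hzb⟩ := EReal.lt_iff_exists_real_btwn.1 hf.one_lt_b
  obtain ⟨u1, hu1⟩ := finR hf (hf.finite_on x1 hax (hx1.trans hf.one_lt_b))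
  obtain ⟨v1, hv1⟩ := finR hf (hf.finite_on z1 (hf.a_lt_one.trans hz1) hzb)
  have hx1' : x1 < 1 := by exact_mod_cast hx1
  have hz1' : 1 < z1 := by exact_mod_cast hz1
  set A : Set ℝ := {s | ∃ x u : ℝ, x < 1 ∧ f x = (u : EReal) ∧ s = u / (x - 1)} with hA
  have hne : A.Nonempty := ⟨_, x1, u1, hx1', hu1, rfl⟩
  have hbd : BddAbove A := ⟨v1 / (z1 - 1), by
    rintro s ⟨x, u, hx, hu, rfl⟩; exact slope_le hf hx hz1' hu hv1⟩
  refine ⟨sSup A, fun x => ?_⟩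
  by_cases ht : f x = ⊤
  · simp [ht]
  obtain ⟨v, hv⟩ := finR hf ht
  rw [hv, EReal.coe_le_coe_iff]
  rcases lt_trichotomy x 1 with h | h | h
  · have := le_csSup hbd ⟨x, v, h, hv, rfl⟩
    rw [div_le_iff_of_neg (by linarith)] at this
    exact this
  · subst h
    rw [hf.at_one] at hv
    have : (0:ℝ) = v := by exact_mod_cast hv
    simp [← this]
  · have : sSup A ≤ v / (x - 1) := csSup_le hne (by
      rintro s ⟨x', u, hx, hu, rfl⟩; exact slope_le hf hx h hu hv)
    rwa [le_div_iff₀ (by linarith)] at this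

theorem strict_side {a b : EReal} {f : ℝ → EReal} (hf : IsF1 a b f)
    (hfs : StrictlyConvexAtOne f) {y0 : ℝ}
    (hy : ∀ x : ℝ, ((y0 * (x - 1) : ℝ) : EReal) ≤ f x) :
    ∃ σ : ℝ, σ * σ = 1 ∧ ∀ d : ℝ, 0 < d → ((y0 * (σ * d) : ℝ) : EReal) < f (1 + σ * d) := by
  by_contra hcon
  push Not at hcon
  obtain ⟨d1, hd1, h1⟩ := hcon (-1) (by norm_num)
  obtain ⟨d2, hd2, h2⟩ := hcon 1 (by norm_num)
  have e1 : f (1 - d1) = ((y0 * (-d1) : ℝ) : EReal) := by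
    apply le_antisymm
    · convert h1 using 2 <;> ring_nf
    · convert hy (1 - d1) using 3; ring
  have e2 : f (1 + d2) = ((y0 * d2 : ℝ) : EReal) := by
    apply le_antisymm
    · convert h2 using 2 <;> ring_nf
    · convert hy (1 + d2) using 3; ring
  refine hfs (min d1 d2) (lt_min hd1 hd2) ⟨y0, -y0, fun x hx => ?_⟩
  obtain ⟨ha, hb⟩ := lt_min_iff.1 hx
  rw [abs_lt] at ha hb
  have hs : 0 < d1 + d2 := by linarith
  have h := convR hf (t := (1 + d2 - x) / (d1 + d2)) (by apply div_pos <;> linarith)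
    (by rw [div_lt_one hs]; linarith) e1 e2
  have e3 : (1 + d2 - x) / (d1 + d2) * (1 - d1) + (1 - (1 + d2 - x) / (d1 + d2)) * (1 + d2) = x := by
    field_simp; ring
  have e4 : (1 + d2 - x) / (d1 + d2) * (y0 * (-d1)) + (1 - (1 + d2 - x) / (d1 + d2)) * (y0 * d2)
      = y0 * x + -y0 := by
    field_simp; ring
  rw [e3, e4] at h
  apply le_antisymm h
  convert hy x using 2; ring

theorem fstar_bound {a b : EReal} {f : ℝ → EReal} (hf : IsF1 a b f)
    {y0 σ : ℝ} (hy : ∀ x : ℝ, ((y0 * (x - 1) : ℝ) : EReal) ≤ f x) (hσ : σ * σ = 1)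
    (hs : ∀ d : ℝ, 0 < d → ((y0 * (σ * d) : ℝ) : EReal) < f (1 + σ * d))
    {δ : ℝ} (hδ : 0 < δ) :
    ∃ κ : ℝ, 0 < κ ∧ ∀ s : ℝ, 0 ≤ s → s ≤ κ →
      fstar f (y0 + σ * s) ≤ ((y0 + σ * s + δ * s : ℝ) : EReal) := by
  obtain ⟨r, hr1, hr2⟩ := EReal.lt_iff_exists_real_btwn.1 (hs δ hδ)
  have hr1' : y0 * (σ * δ) < r := by exact_mod_cast hr1
  refine ⟨(r - y0 * (σ * δ)) / δ, div_pos (by linarith) hδ, fun s hs0 hsk => ?_⟩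
  apply iSup_le
  intro x
  by_cases ht : f x = ⊤
  · simp [ht]
  obtain ⟨v, hv⟩ := finR hf ht
  rw [hv, ← EReal.coe_sub, EReal.coe_le_coe_iff]
  have hyx := hy x
  rw [hv, EReal.coe_le_coe_iff] at hyx
  rcases le_or_gt (σ * (x - 1)) δ with h | h
  · nlinarith [mul_le_mul_of_nonneg_right h hs0]
  · set d := σ * (x - 1) with hd
    have hx : x = 1 + σ * d := by rw [hd, ← mul_assoc, hσ]; ring
    have hd0 : 0 < d := hδ.trans h
    have h1 := convR hf (t := δ / d) (div_pos hδ hd0) ((div_lt_one hd0).2 h) hv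
      (hf.at_one : f 1 = ((0:ℝ):EReal))
    have e : δ / d * x + (1 - δ / d) * 1 = 1 + σ * δ := by rw [hx]; field_simp; ring
    rw [e] at h1
    have h2 := hr2.trans_le h1
    rw [EReal.coe_lt_coe_iff] at h2
    have h3 : r * d < δ * v := by
      have : δ / d * v + (1 - δ / d) * 0 = δ * v / d := by field_simp; ring
      rwa [this, lt_div_iff₀ hd0] at h2
    rw [le_div_iff₀ hδ] at hsk
    have h4 : δ * (y0 * (σ * d) + d * s) ≤ δ * v := by
      nlinarith [mul_le_mul_of_nonneg_right hsk hd0.le]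
    have h5 := le_of_mul_le_mul_left h4 hδ
    have h6 : x * (y0 + σ * s) = y0 + σ * s + y0 * (σ * d) + d * s := by
      rw [hx]; linear_combination (d * s) * hσ
    nlinarith [mul_nonneg hδ.le hs0]

theorem fstar_ge {a b : EReal} {f : ℝ → EReal} (hf : IsF1 a b f) (y : ℝ) :
    (y : EReal) ≤ fstar f y := by
  refine le_trans ?_ (le_iSup _ (1:ℝ))
  simp [hf.at_one]

theorem fstar_meas (f : ℝ → EReal) (hb : ∀ x, f x ≠ ⊥) : Measurable (fstar f) := by
  apply LowerSemicontinuous.measurable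
  apply lowerSemicontinuous_iSup
  intro x
  apply Continuous.lowerSemicontinuous
  by_cases ht : f x = ⊤
  · have : ∀ y : ℝ, ((x * y : ℝ) : EReal) - f x = ⊥ := by intro y; rw [ht]; rfl
    simp only [this]; exact continuous_const
  · have : ∀ y : ℝ, ((x * y : ℝ) : EReal) - f x = ((x * y - (f x).toReal : ℝ) : EReal) := by
      intro y
      rw [EReal.coe_sub, EReal.coe_toReal ht (hb x)]
    simp only [this]
    exact continuous_coe_real_ereal.comp (by fun_prop)

theorem lambda_le {S : Type*} [MeasurableSpace S] {a b : EReal} {f : ℝ → EReal} (hf : IsF1 a b f)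
    {y0 σ : ℝ} (hy : ∀ x : ℝ, ((y0 * (x - 1) : ℝ) : EReal) ≤ f x) (hσ : σ * σ = 1)
    (hs : ∀ d : ℝ, 0 < d → ((y0 * (σ * d) : ℝ) : EReal) < f (1 + σ * d))
    {δ : ℝ} (hδ : 0 < δ) (P : Measure S) [IsProbabilityMeasure P] {g : S → ℝ} {C : ℝ}
    (hC : ∀ x, |g x| ≤ C) (hg : Integrable g P) :
    ∃ t : ℝ, 0 < t ∧ t ≤ 1 ∧
      LambdaF f P (fun x => t * g x) ≤ ((t * (∫ x, g x ∂P) + δ * (2 * C * t) : ℝ) : EReal) := by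
  obtain ⟨κ, hκ, hb⟩ := fstar_bound hf hy hσ hs hδ
  have hσ' : σ = 1 ∨ σ = -1 := mul_self_eq_one_iff.1 hσ
  by_cases hne : Nonempty S
  swap
  · exfalso
    rw [not_nonempty_iff] at hne
    have := measure_univ (μ := P)
    rw [Set.univ_eq_empty_iff.2 hne] at this
    simp at this
  have hC0 : 0 ≤ C := (abs_nonneg _).trans (hC hne.some)
  refine ⟨min 1 (κ / (2 * C + 1)), lt_min one_pos (by positivity), min_le_left _ _, ?_⟩
  set t := min 1 (κ / (2 * C + 1)) with ht
  have ht0 : 0 < t := lt_min one_pos (by positivity)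
  have ht1 : t * (2 * C) ≤ κ := by
    have : t ≤ κ / (2 * C + 1) := min_le_right _ _
    rw [le_div_iff₀ (by positivity)] at this
    nlinarith
  have key : ∀ x, fstar f (t * g x - (-y0 - σ * (t * C))) ≤
      ((y0 + t * g x + σ * (t * C) + δ * (2 * C * t) : ℝ) : EReal) := by
    intro x
    have hx := abs_le.1 (hC x)
    have h0 : 0 ≤ t * (C + σ * g x) := by
      apply mul_nonneg ht0.le
      rcases hσ' with h | h <;> rw [h] <;> linarith
    have h1 : t * (C + σ * g x) ≤ t * (2 * C) := by
      apply mul_le_mul_of_nonneg_left _ ht0.le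
      rcases hσ' with h | h <;> rw [h] <;> linarith
    have e : t * g x - (-y0 - σ * (t * C)) = y0 + σ * (t * (C + σ * g x)) := by
      linear_combination (-(t * g x)) * hσ
    rw [e]
    refine (hb _ h0 (h1.trans ht1)).trans ?_
    rw [EReal.coe_le_coe_iff]
    have := mul_le_mul_of_nonneg_left h1 hδ.le
    have e2 : σ * (t * (C + σ * g x)) = t * g x + σ * (t * C) := by
      linear_combination (t * g x) * hσ
    rw [e2]; linarith
  have hi : Integrable (fun x => y0 + t * g x + σ * (t * C) + δ * (2 * C * t)) P :=
    (((integrable_const y0).add (hg.const_mul t)).add (integrable_const _)).add (integrable_const _)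
  refine (iInf_le _ (-y0 - σ * (t * C))).trans ?_
  refine (add_le_add_right ((eInt_mono P key).trans_eq (eInt_coe hi)) _).trans ?_
  rw [← EReal.coe_add, EReal.coe_le_coe_iff]
  have i1 : Integrable (fun x => y0 + t * g x) P := (integrable_const y0).add (hg.const_mul t)
  have i2 : Integrable (fun x => y0 + t * g x + σ * (t * C)) P := i1.add (integrable_const _)
  rw [integral_add i2 (integrable_const _), integral_add i1 (integrable_const _),
    integral_add (integrable_const y0) (hg.const_mul t), integral_const_mul]
  simp
  linarith

theorem lambda_zero {S : Type*} [MeasurableSpace S] {a b : EReal} {f : ℝ → EReal} (hf : IsF1 a b f)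
    (P : Measure S) [IsProbabilityMeasure P] :
    LambdaF f P (fun _ => (0:ℝ)) ≤ 0 := by
  obtain ⟨y0, hy⟩ := exists_subgrad hf
  have h : fstar f y0 ≤ (y0 : EReal) := by
    apply iSup_le
    intro x
    by_cases ht : f x = ⊤
    · simp [ht]
    obtain ⟨v, hv⟩ := finR hf ht
    have := hy x
    rw [hv, EReal.coe_le_coe_iff] at this
    rw [hv, ← EReal.coe_sub, EReal.coe_le_coe_iff]
    linarith
  refine (iInf_le _ (-y0)).trans ?_
  have k : ∀ x : S, fstar f (0 - -y0) ≤ (y0 : EReal) := by intro x; simpa using h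
  refine (add_le_add_right ((eInt_mono P k).trans_eq (eInt_coe (integrable_const _))) _).trans ?_
  rw [← EReal.coe_add]
  simp

theorem upper {S : Type*} [MeasurableSpace S] {a b : EReal} {f : ℝ → EReal} (hf : IsF1 a b f)
    (hfin : ∀ y : ℝ, fstar f y ≠ ⊤) (Q P : Measure S) [IsProbabilityMeasure Q]
    [IsProbabilityMeasure P] (hQP : Q ≪ P) {g : S → ℝ} (hg : Measurable g)
    (hD : eIntegral P (fun x => f ((Q.rnDeriv P x).toReal)) ≠ ⊤)
    (hE : eIntegral Q (fun x => ((g x : ℝ) : EReal)) ≠ ⊥) :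
    ∃ d : ℝ, eIntegral P (fun x => f ((Q.rnDeriv P x).toReal)) = (d : EReal) ∧
      ∀ ν : ℝ, eIntegral Q (fun x => ((g x : ℝ) : EReal)) ≤
        d + ((ν : EReal) + eIntegral P (fun x => fstar f (g x - ν))) := by
  obtain ⟨y0, hy⟩ := exists_subgrad hf
  set r : S → ℝ := fun x => (Q.rnDeriv P x).toReal with hr
  have hrm : Measurable r := (Measure.measurable_rnDeriv Q P).ennreal_toReal
  have hri : Integrable r P := Measure.integrable_toReal_rnDeriv
  have hr1 : ∫ x, r x ∂P = 1 := by rw [hr, Measure.integral_toReal_rnDeriv hQP]; simp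
  have hr0 : ∀ x, 0 ≤ r x := fun x => ENNReal.toReal_nonneg
  have hAm : Measurable (fun x => f (r x)) := hf.lsc.measurable.comp hrm
  have hneg : ∫⁻ x, posE (-(f (r x))) ∂P ≠ ⊤ := by
    have : ∫⁻ x, posE (-(f (r x))) ∂P ≤ ∫⁻ x, ENNReal.ofReal (-(y0 * (r x - 1))) ∂P := by
      apply lintegral_mono
      intro x
      simp only
      rw [← posE_coe, EReal.coe_neg]
      exact posE_mono (EReal.neg_le_neg_iff.2 (hy _))
    exact ne_top_of_le_ne_top
      (lint_ne_top (((hri.sub (integrable_const 1)).const_mul y0).neg)) this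
  have hpos : ∫⁻ x, posE (f (r x)) ∂P ≠ ⊤ := by
    intro h
    apply hD
    unfold eIntegral
    rw [h, ereal_coe_ennreal hneg]
    rfl
  have hposm : Measurable posE := by
    apply Monotone.measurable
    intro x y h
    exact posE_mono h
  have hae : ∀ᵐ x ∂P, f (r x) = ((f (r x)).toReal : EReal) := by
    filter_upwards [ae_lt_top (hposm.comp hAm) hpos] with x hx
    refine (EReal.coe_toReal ?_ (hf.ne_bot _)).symm
    intro h
    simp [posE, h] at hx
  set u : S → ℝ := fun x => (f (r x)).toReal with hu
  have hum : Measurable u := measurable_ereal_toReal.comp hAm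
  have hui : Integrable u P := by
    apply int_of hum.aestronglyMeasurable
    · rw [← lintegral_congr_ae (f := fun x => posE (f (r x)))]
      · exact hpos
      · filter_upwards [hae] with x hx
        rw [hx, posE_coe]
    · rw [← lintegral_congr_ae (f := fun x => posE (-(f (r x))))]
      · exact hneg
      · filter_upwards [hae] with x hx
        rw [hx, ← EReal.coe_neg, posE_coe]
  refine ⟨∫ x, u x ∂P, ?_, ?_⟩
  · rw [← eInt_coe hui]; exact eInt_congr P hae
  intro ν
  have hgn : ∫⁻ x, ENNReal.ofReal (-(g x)) ∂Q ≠ ⊤ := by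
    intro h
    apply hE
    rw [eInt_coe_def, h]
    simp
  set n : S → ℝ := fun x => max (-(g x)) 0 with hn
  have hnm : Measurable n := hg.neg.max measurable_const
  have hni : Integrable n Q := by
    apply int_of hnm.aestronglyMeasurable
    · convert hgn using 3 with x
      rcases le_total (-(g x)) 0 with h | h
      · simp [hn, h, ENNReal.ofReal_of_nonpos h]
      · simp only [hn, max_eq_left h]
    · convert ENNReal.zero_ne_top
      rw [lintegral_eq_zero_of_ae_eq_zero]
      filter_upwards with x
      simp [hn]
  have hrn : Integrable (fun x => r x * n x) P := (integrable_toReal_rnDeriv_mul_iff hQP).2 hni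
  set h : S → ℝ := fun x => (fstar f (g x - ν)).toReal with hh
  have hhm : Measurable h := measurable_ereal_toReal.comp
    ((fstar_meas f hf.ne_bot).comp (hg.sub_const ν))
  have hhe : ∀ x, fstar f (g x - ν) = (h x : EReal) := by
    intro x
    refine (EReal.coe_toReal (hfin _) ?_).symm
    intro hb
    have := fstar_ge hf (g x - ν)
    rw [hb] at this
    exact EReal.coe_ne_bot _ (le_bot_iff.1 this)
  have FY : ∀ᵐ x ∂P, r x * (g x - ν) ≤ u x + h x := by
    filter_upwards [hae] with x hx
    have h1 : ((r x * (g x - ν) : ℝ) : EReal) - f (r x) ≤ fstar f (g x - ν) :=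
      le_iSup (fun z : ℝ => ((z * (g x - ν) : ℝ) : EReal) - f z) (r x)
    rw [hx, hhe, ← EReal.coe_sub, EReal.coe_le_coe_iff] at h1
    change r x * (g x - ν) - u x ≤ h x at h1
    linarith
  have hhn : ∫⁻ x, ENNReal.ofReal (-(h x)) ∂P ≠ ⊤ := by
    refine ne_top_of_le_ne_top (lint_ne_top ((hui.add hrn).add (hri.mul_const ν))) ?_
    apply lintegral_mono_ae
    filter_upwards [FY] with x hx
    apply ENNReal.ofReal_le_ofReal
    have : -(g x) ≤ n x := le_max_left _ _
    have := mul_le_mul_of_nonneg_left this (hr0 x)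
    simp only [Pi.add_apply]
    linarith
  simp only [hhe]
  by_cases hhp : ∫⁻ x, ENNReal.ofReal (h x) ∂P = ⊤
  · rw [eInt_coe_def P, hhp, ereal_coe_ennreal hhn]
    have : ((⊤ : ℝ≥0∞) : EReal) - (((∫⁻ x, ENNReal.ofReal (-(h x)) ∂P).toReal : ℝ) : EReal) = ⊤ := rfl
    rw [this]
    simp
  have hhi : Integrable h P := int_of hhm.aestronglyMeasurable hhp hhn
  have hbd : Integrable (fun x => u x + h x + r x * ν) P := (hui.add hhi).add (hri.mul_const ν)
  have hrg : Integrable (fun x => r x * g x) P := by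
    have hm : Measurable (fun x => r x * g x) := hrm.mul hg
    apply int_of hm.aestronglyMeasurable
    · refine ne_top_of_le_ne_top (lint_ne_top hbd) ?_
      apply lintegral_mono_ae
      filter_upwards [FY] with x hx
      apply ENNReal.ofReal_le_ofReal
      linarith
    · refine ne_top_of_le_ne_top (lint_ne_top hrn) ?_
      apply lintegral_mono
      intro x
      apply ENNReal.ofReal_le_ofReal
      have : -(g x) ≤ n x := le_max_left _ _
      have := mul_le_mul_of_nonneg_left this (hr0 x)
      linarith
  have hgi : Integrable g Q := (integrable_toReal_rnDeriv_mul_iff hQP).1 hrg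
  rw [eInt_coe hgi, eInt_coe hhi, ← EReal.coe_add, ← EReal.coe_add, EReal.coe_le_coe_iff,
    ← integral_toReal_rnDeriv_mul hQP]
  have h1 : ∫ x, r x * g x ∂P ≤ ∫ x, (u x + h x + r x * ν) ∂P := by
    apply integral_mono_ae hrg hbd
    filter_upwards [FY] with x hx
    linarith
  have i1 : Integrable (fun x => u x + h x) P := hui.add hhi
  rw [integral_add i1 (hri.mul_const ν), integral_add hui hhi, integral_mul_const,
    hr1] at h1
  change ∫ x, r x * g x ∂P ≤ _
  linarith

theorem DfV_le {S : Type*} [MeasurableSpace S] {a b : EReal} {f : ℝ → EReal} (hf : IsF1 a b f)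
    (hfin : ∀ y : ℝ, fstar f y ≠ ⊤) (Γt : Set (S → ℝ)) (hΓt : ∀ g ∈ Γt, Measurable g)
    (V : (S → ℝ) → Measure S → Measure S → ℝ≥0∞) (Q P : Measure S) [IsProbabilityMeasure Q]
    [IsProbabilityMeasure P] : DfV f Γt V Q P ≤ fDivE f Q P := by
  unfold fDivE
  split_ifs with hQP
  swap
  · exact le_top
  by_cases hD : eIntegral P (fun x => f ((Q.rnDeriv P x).toReal)) = ⊤
  · rw [hD]; exact le_top
  apply iSup₂_le
  intro g hg
  have hV : ∀ z : EReal, z - ((V g Q P : ℝ≥0∞) : EReal) ≤ z := by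
    intro z
    have := EReal.sub_le_sub (le_refl z) (show (0:EReal) ≤ ((V g Q P : ℝ≥0∞) : EReal) from EReal.coe_ennreal_nonneg _)
    simpa using this
  refine (hV _).trans ?_
  by_cases hE : eIntegral Q (fun x => ((g x : ℝ) : EReal)) = ⊥
  · rw [hE]; simp
  obtain ⟨d, hd, hν⟩ := upper hf hfin Q P hQP (hΓt g hg) hD hE
  rw [hd]
  apply EReal.sub_le_of_le_add
  have : eIntegral Q (fun x => ((g x : ℝ) : EReal)) - (d : EReal) ≤ LambdaF f P g := by
    apply le_iInf
    intro ν
    exact EReal.sub_le_of_le_add' (hν ν)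
  rw [add_comm]
  exact (EReal.sub_le_iff_le_add (by simp) (by simp)).1 this

/-- Soft constraints preserve the divergence property: for strictly
admissible `f` and `Γ`, `Γ ⊆ Γ̃ ⊆ M(S)`, and a penalty `V ≥ 0` vanishing on
`Γ × P(S) × P(S)`, the quantity `D_f^V` has the divergence property and
`D_f^Γ(Q‖P) ≤ D_f^V(Q‖P) ≤ D_f(Q‖P)` for all Borel probability measures `Q, P`. -/
theorem stmt18 {S : Type*} [MetricSpace S] [CompleteSpace S]
    [TopologicalSpace.SeparableSpace S] [MeasurableSpace S] [BorelSpace S]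
    (a b : EReal) (f : ℝ → EReal) (hf : IsF1 a b f) (hfa : AdmissibleF f)
    (hfs : StrictlyConvexAtOne f)
    (Γ : Set (S → ℝ)) (hΓ : AdmissibleGamma Γ) (hΓs : StrictlyAdmissibleGamma Γ)
    (Γt : Set (S → ℝ)) (hΓΓt : Γ ⊆ Γt) (hΓt : ∀ g ∈ Γt, Measurable g)
    (V : (S → ℝ) → Measure S → Measure S → ℝ≥0∞)
    (hV : ∀ g ∈ Γ, ∀ Q P : Measure S, IsProbabilityMeasure Q → IsProbabilityMeasure P →
      V g Q P = 0) :
    (∀ Q P : Measure S, IsProbabilityMeasure Q → IsProbabilityMeasure P →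
      0 ≤ DfV f Γt V Q P ∧ (DfV f Γt V Q P = 0 ↔ Q = P))
    ∧ (∀ Q P : Measure S, IsProbabilityMeasure Q → IsProbabilityMeasure P →
      fGammaDiv f Γ Q P ≤ DfV f Γt V Q P ∧ DfV f Γt V Q P ≤ fDivE f Q P) := by
  have hint : ∀ g ∈ Γ, ∀ Q : Measure S, IsProbabilityMeasure Q → Integrable g Q := by
    intro g hg Q hQ
    obtain ⟨hc, C, hC⟩ := hΓ.2.2.1 hg
    exact Integrable.of_bound hc.measurable.aestronglyMeasurable C
      (Eventually.of_forall fun x => by simpa using hC x)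
  have hlow : ∀ Q P : Measure S, IsProbabilityMeasure Q → IsProbabilityMeasure P →
      fGammaDiv f Γ Q P ≤ DfV f Γt V Q P := by
    intro Q P hQ hP
    apply iSup₂_le
    intro g hg
    refine le_trans ?_ (le_iSup₂ (f := fun g (_ : g ∈ Γt) =>
      ((eIntegral Q (fun x => ((g x : ℝ) : EReal)) - LambdaF f P g)
        - ((V g Q P : ℝ≥0∞) : EReal))) g (hΓΓt hg))
    simp only [hV g hg Q P hQ hP, eInt_coe (hint g hg Q hQ)]
    simp
  have hup : ∀ Q P : Measure S, IsProbabilityMeasure Q → IsProbabilityMeasure P →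
      DfV f Γt V Q P ≤ fDivE f Q P := by
    intro Q P hQ hP
    exact DfV_le hf hfa.1 Γt hΓt V Q P
  have hnn : ∀ Q P : Measure S, IsProbabilityMeasure Q → IsProbabilityMeasure P →
      0 ≤ DfV f Γt V Q P := by
    intro Q P hQ hP
    refine le_trans ?_ (hlow Q P hQ hP)
    refine le_trans ?_ (le_iSup₂ (f := fun g (_ : g ∈ Γ) =>
      (((∫ x, g x ∂Q : ℝ) : EReal) - LambdaF f P g)) _ hΓ.1)
    have := EReal.sub_le_sub (le_refl (0:EReal)) (lambda_zero hf P)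
    simpa using this
  refine ⟨fun Q P hQ hP => ⟨hnn Q P hQ hP, ?_, ?_⟩, fun Q P hQ hP => ⟨hlow Q P hQ hP, hup Q P hQ hP⟩⟩
  · intro h0
    have hG : ∀ g ∈ Γ, ((∫ x, g x ∂Q : ℝ) : EReal) ≤ LambdaF f P g := by
      intro g hg
      have h1 : ((∫ x, g x ∂Q : ℝ) : EReal) - LambdaF f P g ≤ 0 := by
        refine le_trans ?_ ((hlow Q P hQ hP).trans_eq h0)
        exact le_iSup₂ (f := fun g (_ : g ∈ Γ) =>
          (((∫ x, g x ∂Q : ℝ) : EReal) - LambdaF f P g)) g hg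
      generalize LambdaF f P g = z at h1
      induction z with
      | bot => simp at h1
      | top => simp
      | coe z =>
        rw [← EReal.coe_sub] at h1
        have : (∫ x, g x ∂Q) - z ≤ 0 := by exact_mod_cast h1
        rw [EReal.coe_le_coe_iff]; linarith
    obtain ⟨y0, hy⟩ := exists_subgrad hf
    obtain ⟨σ, hσ, hs⟩ := strict_side hf hfs hy
    have hle : ∀ g ∈ Γ, ∫ x, g x ∂Q ≤ ∫ x, g x ∂P := by
      intro g hg
      obtain ⟨hc, C, hC⟩ := hΓ.2.2.1 hg
      apply _root_.le_of_forall_pos_le_add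
      intro e he
      obtain ⟨t, ht0, ht1, hL⟩ := lambda_le hf hy hσ hs (δ := e / (2 * |C| + 1)) (by positivity)
        P (C := |C|) (fun x => (hC x).trans (le_abs_self C)) (hint g hg P hP)
      have hm : (fun x => t * g x) ∈ Γ := by
        have := hΓ.2.1 hg hΓ.1 ht0.le (sub_nonneg.2 ht1) (by ring)
        convert this using 1
        ext x
        simp
      have h2 := (hG _ hm).trans hL
      rw [EReal.coe_le_coe_iff, integral_const_mul] at h2
      have h3 : e / (2 * |C| + 1) * (2 * |C| * t) ≤ t * e := by
        rw [div_mul_eq_mul_div, div_le_iff₀ (by positivity)]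
        nlinarith [mul_pos he ht0]
      have h4 : t * ∫ x, g x ∂Q ≤ t * (∫ x, g x ∂P + e) := by linarith
      exact le_of_mul_le_mul_left h4 ht0
    obtain ⟨Ψ, hΨ, hdet, hc⟩ := hΓs
    apply hdet Q P hQ hP
    intro ψ hψ
    obtain ⟨c, ε, hε, hp, hm⟩ := hc ψ hψ
    have hψi : ∀ R : Measure S, IsProbabilityMeasure R → Integrable ψ R := by
      intro R hR
      obtain ⟨hc, C, hC⟩ := hΨ hψ
      exact Integrable.of_bound hc.measurable.aestronglyMeasurable C
        (Eventually.of_forall fun x => by simpa using hC x)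
    have h1 := hle _ hp
    have h2 := hle _ hm
    rw [integral_add (integrable_const c) ((hψi Q hQ).const_mul ε),
      integral_add (integrable_const c) ((hψi P hP).const_mul ε), integral_const_mul,
      integral_const_mul] at h1
    rw [integral_sub (integrable_const c) ((hψi Q hQ).const_mul ε),
      integral_sub (integrable_const c) ((hψi P hP).const_mul ε), integral_const_mul,
      integral_const_mul] at h2
    simp only [integral_const, probReal_univ, one_smul] at h1 h2
    apply le_antisymm
    · exact le_of_mul_le_mul_left (by linarith) hε
    · exact le_of_mul_le_mul_left (by linarith) hε
  · rintro rfl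
    apply le_antisymm _ (hnn Q Q hQ hQ)
    refine (hup Q Q hQ hQ).trans ?_
    unfold fDivE
    rw [if_pos Measure.AbsolutelyContinuous.rfl]
    rw [eInt_congr Q (k := fun _ => ((0:ℝ):EReal))]
    · rw [eInt_coe (integrable_const _)]; simp
    · filter_upwards [Measure.rnDeriv_self Q] with x hx
      rw [hx]; simpa using hf.at_one
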